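/- Let r ≥ 1 be an integer, let c > 0 be a real number, and let s′, s″ be real numbers with s′ > c and s″ > c. Then there exists a positive integer N such that the function on ((0,∞)²)^r given by ((t_1′,t_1″),…,(t_r′,t_r″)) ↦ (∏_{i=1}^r ((t_i′ + t_i′⁻¹)(t_i″ + t_i″⁻¹))^c) · (∏_{i=1}^r t_i′)^{s′} · (∏_{i=1}^r t_i″)^{s″} · (∏_{i=1}^{r-1} ((1 + t_i′/t_{i+1}′)(1 + t_i″/t_{i+1}″))^{-N}) · ((1 + t_r′)(1 + t_r″))^{-N} is integrable with respect to the product measure ∏_{i=1}^r (dt_i′/t_i′)(dt_i″/t_i″); in particular the corresponding integral is finite. -/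

import Mathlib

open MeasureTheory

/-- The multiplicative Haar measure `dt/t` on `(0,∞)`, as a Borel measure on `ℝ`. -/
noncomputable def mulHaarPos : Measure ℝ :=
  (volume.restrict (Set.Ioi (0 : ℝ))).withDensity fun t => ENNReal.ofReal t⁻¹

/-- Extension of a vector `x ∈ (ℝ²)^r` to a function on `ℕ` (by `(1,1)` outside
`{0,…,r-1}`), used to write products indexed by natural numbers. -/
noncomputable def ext2 {r : ℕ} (x : Fin r → ℝ × ℝ) (i : ℕ) : ℝ × ℝ :=
  if h : i < r then x ⟨i, h⟩ else (1, 1)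

instance mulHaarPos_sigmaFinite : SigmaFinite mulHaarPos := by
  unfold mulHaarPos
  exact SigmaFinite.withDensity_ofReal _

lemma mulHaarPos_ae_pos : ∀ᵐ t ∂mulHaarPos, 0 < t :=
  (withDensity_absolutelyContinuous _ _).ae_le (ae_restrict_mem measurableSet_Ioi)

/-- On `(0,∞)` the function `(t + t⁻¹)^c t^s (1 + t)^{-M}` is integrable for `dt/t` as soon as
`c < s` and `s + c < M`. -/
lemma integrable_mulHaarPos_rpow (c s M : ℝ) (hc : 0 < c) (hs : c < s) (hM : s + c < M) :
    Integrable (fun t : ℝ => (t + t⁻¹) ^ c * t ^ s * (1 + t) ^ (-M)) mulHaarPos := by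
  unfold mulHaarPos
  rw [integrable_withDensity_iff (by fun_prop) (by simp)]
  have hmeas : Measurable fun t : ℝ =>
      (t + t⁻¹) ^ c * t ^ s * (1 + t) ^ (-M) * (ENNReal.ofReal t⁻¹).toReal := by fun_prop
  change IntegrableOn _ (Set.Ioi 0) _
  rw [← Set.Ioc_union_Ioi_eq_Ioi (zero_le_one' ℝ)]
  refine IntegrableOn.union ?_ ?_
  · have h : IntegrableOn (fun t : ℝ => 2 ^ c * t ^ (s - c - 1)) (Set.Ioc 0 1) := by
      refine Integrable.const_mul ?_ _
      exact (intervalIntegrable_iff_integrableOn_Ioc_of_le zero_le_one).1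
        (intervalIntegral.intervalIntegrable_rpow' (by linarith))
    refine Integrable.mono' h hmeas.aestronglyMeasurable ?_
    filter_upwards [ae_restrict_mem measurableSet_Ioc] with t ht
    obtain ⟨h0, h1⟩ := ht
    have hinv : 0 < t⁻¹ := inv_pos.2 h0
    rw [ENNReal.toReal_ofReal hinv.le, Real.norm_of_nonneg (by positivity)]
    have e1 : (t + t⁻¹) ^ c ≤ 2 ^ c * t ^ (-c) := by
      rw [Real.rpow_neg h0.le, ← Real.inv_rpow h0.le, ← Real.mul_rpow zero_le_two hinv.le]
      have := (one_le_inv₀ h0).2 h1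
      exact Real.rpow_le_rpow (by positivity) (by linarith) hc.le
    have e2 : (1 + t) ^ (-M) ≤ 1 :=
      Real.rpow_le_one_of_one_le_of_nonpos (by linarith) (by linarith)
    calc (t + t⁻¹) ^ c * t ^ s * (1 + t) ^ (-M) * t⁻¹
        ≤ (2 ^ c * t ^ (-c)) * t ^ s * 1 * t⁻¹ := by gcongr
      _ = 2 ^ c * t ^ (s - c - 1) := by
        rw [show s - c - 1 = -c + s + -1 by ring, Real.rpow_add h0, Real.rpow_add h0,
          Real.rpow_neg_one]
        ring
  · have h : IntegrableOn (fun t : ℝ => 2 ^ c * t ^ (s + c - M - 1)) (Set.Ioi 1) :=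
      (integrableOn_Ioi_rpow_of_lt (by linarith) one_pos).const_mul _
    refine Integrable.mono' h hmeas.aestronglyMeasurable ?_
    filter_upwards [ae_restrict_mem measurableSet_Ioi] with t ht
    have h1 : 1 < t := ht
    have h0 : 0 < t := by linarith
    have hinv : 0 < t⁻¹ := inv_pos.2 h0
    rw [ENNReal.toReal_ofReal hinv.le, Real.norm_of_nonneg (by positivity)]
    have e1 : (t + t⁻¹) ^ c ≤ 2 ^ c * t ^ c := by
      rw [← Real.mul_rpow zero_le_two h0.le]
      have := inv_le_one_of_one_le₀ h1.le
      exact Real.rpow_le_rpow (by positivity) (by linarith) hc.le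
    have e2 : (1 + t) ^ (-M) ≤ t ^ (-M) :=
      Real.rpow_le_rpow_of_nonpos h0 (by linarith) (by linarith)
    calc (t + t⁻¹) ^ c * t ^ s * (1 + t) ^ (-M) * t⁻¹
        ≤ (2 ^ c * t ^ c) * t ^ s * t ^ (-M) * t⁻¹ := by gcongr
      _ = 2 ^ c * t ^ (s + c - M - 1) := by
        rw [show s + c - M - 1 = c + s + -M + -1 by ring, Real.rpow_add h0, Real.rpow_add h0,
          Real.rpow_add h0, Real.rpow_neg_one]
        ring

lemma one_add_le_prod_ratio (T : ℕ → ℝ) (hT : ∀ i, 0 < T i) (n : ℕ) :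
    ∀ i ≤ n, 1 + T i ≤ (∏ j ∈ Finset.range n, (1 + T j / T (j + 1))) * (1 + T n) := by
  induction n with
  | zero =>
    intro i hi
    obtain rfl : i = 0 := by omega
    simp
  | succ n ih =>
    intro i hi
    have hn := hT n
    have hn1 := hT (n + 1)
    have hq : 0 < T n / T (n + 1) := div_pos hn hn1
    rcases Nat.lt_or_ge n i with h | h
    · obtain rfl : i = n + 1 := by omega
      have : 1 ≤ ∏ j ∈ Finset.range (n + 1), (1 + T j / T (j + 1)) :=
        Finset.one_le_prod fun j _ => by
          have := div_pos (hT j) (hT (j + 1))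
          linarith
      exact le_mul_of_one_le_left (by linarith) this
    · have hP : 0 ≤ ∏ j ∈ Finset.range n, (1 + T j / T (j + 1)) :=
        Finset.prod_nonneg fun j _ => by
          have := div_pos (hT j) (hT (j + 1))
          linarith
      have hmul : T n / T (n + 1) * T (n + 1) = T n := div_mul_cancel₀ _ hn1.ne'
      rw [Finset.prod_range_succ, mul_assoc]
      exact (ih i h).trans (mul_le_mul_of_nonneg_left (by nlinarith) hP)

lemma prod_ratio_rpow_le (r M : ℕ) (T : ℕ → ℝ) (hT : ∀ i, 0 < T i) :
    (∏ i ∈ Finset.range (r - 1), (1 + T i / T (i + 1)) ^ (-((r * M : ℕ) : ℝ))) *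
      (1 + T (r - 1)) ^ (-((r * M : ℕ) : ℝ)) ≤
    ∏ i ∈ Finset.range r, (1 + T i) ^ (-(M : ℝ)) := by
  have hq : ∀ i, 0 < 1 + T i / T (i + 1) := fun i => by
    have := div_pos (hT i) (hT (i + 1))
    linarith
  have h1 : ∀ i, 0 < 1 + T i := fun i => by linarith [hT i]
  rw [Real.finsetProd_rpow _ _ fun i _ => (hq i).le, Real.finsetProd_rpow _ _ fun i _ => (h1 i).le,
    ← Real.mul_rpow (Finset.prod_nonneg fun i _ => (hq i).le) (h1 _).le]
  set D := (∏ i ∈ Finset.range (r - 1), (1 + T i / T (i + 1))) * (1 + T (r - 1))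
  have hD : 0 < D := mul_pos (Finset.prod_pos fun i _ => hq i) (h1 _)
  have hle : ∏ i ∈ Finset.range r, (1 + T i) ≤ D ^ r := by
    calc ∏ i ∈ Finset.range r, (1 + T i) ≤ ∏ _i ∈ Finset.range r, D :=
          Finset.prod_le_prod (fun i _ => (h1 i).le) fun i hi =>
            one_add_le_prod_ratio T hT (r - 1) i (by have := Finset.mem_range.1 hi; omega)
      _ = D ^ r := by simp
  have hexp : D ^ (-((r * M : ℕ) : ℝ)) = (D ^ r) ^ (-(M : ℝ)) := by
    rw [← Real.rpow_natCast D r, ← Real.rpow_mul hD.le]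
    push_cast
    ring_nf
  rw [hexp]
  exact Real.rpow_le_rpow_of_nonpos (Finset.prod_pos fun i _ => h1 i) hle (by simp)

lemma measurable_ext2 {r : ℕ} (i : ℕ) : Measurable fun x : Fin r → ℝ × ℝ => ext2 x i := by
  unfold ext2
  split_ifs <;> fun_prop

/-- Case `d_𝕂 = 2` of the convergence lemma: for `r ≥ 1`, `c > 0` and `s′, s″ > c`,
there is a positive integer `N` such that the function
`((t′,t″) : ((0,∞)²)^r) ↦ (∏ i ((t′ i + t′ i⁻¹)(t″ i + t″ i⁻¹))^c) (∏ i t′ i)^{s′}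
(∏ i t″ i)^{s″} (∏_{i<r-1} ((1 + t′ i/t′ (i+1))(1 + t″ i/t″ (i+1))))^{-N}
((1 + t′ (r-1))(1 + t″ (r-1)))^{-N}`
is integrable for the product measure `∏ (dt′_i/t′_i)(dt″_i/t″_i)`. -/
theorem stmt1 (r : ℕ) (hr : 1 ≤ r) (c s' s'' : ℝ) (hc : 0 < c)
    (hs' : c < s') (hs'' : c < s'') :
    ∃ N : ℕ, 0 < N ∧
      Integrable
        (fun x : Fin r → ℝ × ℝ =>
          (∏ i, (((x i).1 + ((x i).1)⁻¹) * ((x i).2 + ((x i).2)⁻¹)) ^ c) *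
          (∏ i, (x i).1) ^ s' * (∏ i, (x i).2) ^ s'' *
          (∏ i ∈ Finset.range (r - 1),
            ((1 + (ext2 x i).1 / (ext2 x (i + 1)).1) *
             (1 + (ext2 x i).2 / (ext2 x (i + 1)).2)) ^ (-(N : ℝ))) *
          ((1 + (ext2 x (r - 1)).1) * (1 + (ext2 x (r - 1)).2)) ^ (-(N : ℝ)))
        (Measure.pi fun _ : Fin r => mulHaarPos.prod mulHaarPos) := by
  obtain ⟨M, hM⟩ := exists_nat_gt (max (s' + c) (s'' + c))
  have hM1 : s' + c < M := (le_max_left _ _).trans_lt hM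
  have hM2 : s'' + c < M := (le_max_right _ _).trans_lt hM
  have hM0 : 0 < M := by
    have : (0 : ℝ) < M := by linarith
    exact_mod_cast this
  refine ⟨r * M, by positivity, ?_⟩
  have hint := Integrable.fintype_prod (ι := Fin r) (μ := fun _ => mulHaarPos.prod mulHaarPos)
    (f := fun _ (p : ℝ × ℝ) => ((p.1 + p.1⁻¹) ^ c * p.1 ^ s' * (1 + p.1) ^ (-(M : ℝ))) *
      ((p.2 + p.2⁻¹) ^ c * p.2 ^ s'' * (1 + p.2) ^ (-(M : ℝ))))
    fun _ => (integrable_mulHaarPos_rpow c s' M hc hs' hM1).mul_prod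
      (integrable_mulHaarPos_rpow c s'' M hc hs'' hM2)
  refine hint.mono' ?_ ?_
  · have := @measurable_ext2 r
    refine Measurable.aestronglyMeasurable ?_
    fun_prop
  have hpair : ∀ᵐ p ∂mulHaarPos.prod mulHaarPos, 0 < p.1 ∧ 0 < p.2 :=
    (Measure.quasiMeasurePreserving_fst.ae mulHaarPos_ae_pos).and
      (Measure.quasiMeasurePreserving_snd.ae mulHaarPos_ae_pos)
  have hpos : ∀ᵐ x ∂(Measure.pi fun _ : Fin r => mulHaarPos.prod mulHaarPos),
      ∀ i, 0 < (x i).1 ∧ 0 < (x i).2 :=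
    ae_all_iff.2 fun i => (Measure.quasiMeasurePreserving_eval
      (fun _ : Fin r => mulHaarPos.prod mulHaarPos) i).ae hpair
  filter_upwards [hpos] with x hx
  have hT : ∀ i, 0 < (ext2 x i).1 ∧ 0 < (ext2 x i).2 := fun i => by
    unfold ext2
    split_ifs
    · exact hx _
    · simp
  have hq1 : ∀ i, 0 < 1 + (ext2 x i).1 / (ext2 x (i + 1)).1 := fun i =>
    add_pos one_pos (div_pos (hT i).1 (hT (i + 1)).1)
  have hq2 : ∀ i, 0 < 1 + (ext2 x i).2 / (ext2 x (i + 1)).2 := fun i =>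
    add_pos one_pos (div_pos (hT i).2 (hT (i + 1)).2)
  have hz1 : ∀ i, 0 < (x i).1 + ((x i).1)⁻¹ := fun i =>
    add_pos (hx i).1 (inv_pos.2 (hx i).1)
  have hz2 : ∀ i, 0 < (x i).2 + ((x i).2)⁻¹ := fun i =>
    add_pos (hx i).2 (inv_pos.2 (hx i).2)
  have hl1 : 0 < 1 + (ext2 x (r - 1)).1 := add_pos one_pos (hT _).1
  have hl2 : 0 < 1 + (ext2 x (r - 1)).2 := add_pos one_pos (hT _).2
  have b1 := prod_ratio_rpow_le r M (fun i => (ext2 x i).1) fun i => (hT i).1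
  have b2 := prod_ratio_rpow_le r M (fun i => (ext2 x i).2) fun i => (hT i).2
  rw [Finset.prod_range fun i => (1 + (ext2 x i).1) ^ (-(M : ℝ))] at b1
  rw [Finset.prod_range fun i => (1 + (ext2 x i).2) ^ (-(M : ℝ))] at b2
  have hext : ∀ i : Fin r, ext2 x i = x i := fun i => by simp [ext2]
  simp only [hext] at b1 b2
  have hx1 : 0 < ∏ i, (x i).1 := Finset.prod_pos fun i _ => (hx i).1
  have hx2 : 0 < ∏ i, (x i).2 := Finset.prod_pos fun i _ => (hx i).2
  have hA : 0 ≤ (∏ i, ((x i).1 + ((x i).1)⁻¹) ^ c) * (∏ i, ((x i).2 + ((x i).2)⁻¹) ^ c) *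
      (∏ i, (x i).1 ^ s') * (∏ i, (x i).2 ^ s'') := by
    have h1 := fun i => (hx i).1
    have h2 := fun i => (hx i).2
    refine mul_nonneg (mul_nonneg (mul_nonneg ?_ ?_) ?_) ?_ <;>
      refine Finset.prod_nonneg fun i _ => Real.rpow_nonneg ?_ _
    exacts [(hz1 i).le, (hz2 i).le, (h1 i).le, (h2 i).le]
  have hB2 : 0 ≤ (∏ i ∈ Finset.range (r - 1),
      (1 + (ext2 x i).2 / (ext2 x (i + 1)).2) ^ (-((r * M : ℕ) : ℝ))) *
      (1 + (ext2 x (r - 1)).2) ^ (-((r * M : ℕ) : ℝ)) :=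
    mul_nonneg (Finset.prod_nonneg fun i _ => Real.rpow_nonneg (hq2 i).le _)
      (Real.rpow_nonneg hl2.le _)
  have hC1 : 0 ≤ ∏ i, (1 + (x i).1) ^ (-(M : ℝ)) :=
    Finset.prod_nonneg fun i _ => Real.rpow_nonneg (add_pos one_pos (hx i).1).le _
  have key := mul_le_mul_of_nonneg_left (mul_le_mul b1 b2 hB2 hC1) hA
  rw [Real.norm_of_nonneg]
  · simp only [Real.mul_rpow (hz1 _).le (hz2 _).le, Real.mul_rpow (hq1 _).le (hq2 _).le,
      Real.mul_rpow hl1.le hl2.le, Finset.prod_mul_distrib,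
      ← Real.finsetProd_rpow _ _ fun i _ => (hx i).1.le,
      ← Real.finsetProd_rpow _ _ fun i _ => (hx i).2.le]
    refine le_trans (le_of_eq ?_) (key.trans (le_of_eq ?_)) <;> ring
  · refine mul_nonneg (mul_nonneg (mul_nonneg (mul_nonneg ?_ ?_) ?_) ?_) ?_
    · exact Finset.prod_nonneg fun i _ => Real.rpow_nonneg (mul_pos (hz1 i) (hz2 i)).le _
    · exact Real.rpow_nonneg hx1.le _
    · exact Real.rpow_nonneg hx2.le _
    · exact Finset.prod_nonneg fun i _ => Real.rpow_nonneg (mul_pos (hq1 i) (hq2 i)).le _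
    · exact Real.rpow_nonneg (mul_pos hl1 hl2).le _
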